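/- Let F be a nonempty finite set, X a nonempty set, T a positive integer, and ℓ : F × X → ℝ with |ℓ(f,x)| ≤ 1 for all f, x. Let x_1,…,x_T ∈ X. Suppose for each 1 ≤ t ≤ T there is λ_t > 0 attaining inf_{λ>0} [ (1/λ)·log( Σ_{f∈F} exp(−λ Σ_{i=1}^{t−1} ℓ(f,x_i)) ) + 2λ(T−t+1) ], and the learner plays the Exponential Weights distribution q_t(f) = exp(−λ_t Σ_{i=1}^{t−1} ℓ(f,x_i)) / Σ_{g∈F} exp(−λ_t Σ_{i=1}^{t−1} ℓ(g,x_i)). Then Σ_{t=1}^T Σ_{f∈F} q_t(f)·ℓ(f,x_t) − min_{f∈F} Σ_{t=1}^T ℓ(f,x_t) ≤ 2·√(2 T log|F|). -/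

import Mathlib

/-- The exponential moment of a `[-1, 1]`-valued function under finite weights, bounded by
symmetrization. -/
theorem sum_mul_exp_neg_mul_le {F : Type*} [Fintype F] (q y : F → ℝ) (hq : ∀ f, 0 ≤ q f)
    (hq1 : ∑ f, q f = 1) (hy : ∀ f, |y f| ≤ 1) (l : ℝ) :
    ∑ f, q f * Real.exp (-l * y f) ≤ Real.exp (2 * l ^ 2 - l * ∑ f, q f * y f) := by
  have jensen : Real.exp (l * ∑ f, q f * y f) ≤ ∑ f, q f * Real.exp (l * y f) := by
    have h := convexOn_exp.map_sum_le (t := Finset.univ) (w := q) (p := fun f => l * y f)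
      (fun f _ => hq f) hq1 (fun f _ => Set.mem_univ _)
    simp only [smul_eq_mul] at h
    rwa [Finset.mul_sum, Finset.sum_congr rfl fun f _ => mul_left_comm l (q f) (y f)]
  have prod_eq : (∑ f, q f * Real.exp (-l * y f)) * ∑ g, q g * Real.exp (l * y g)
      = ∑ f, ∑ g, q f * q g * Real.exp (l * (y g - y f)) := by
    rw [Finset.sum_mul_sum]
    refine Finset.sum_congr rfl fun f _ => Finset.sum_congr rfl fun g _ => ?_
    rw [show l * (y g - y f) = -l * y f + l * y g by ring, Real.exp_add]
    ring
  have prod_symm : ∑ f, ∑ g, q f * q g * Real.exp (l * (y g - y f))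
      = ∑ f, ∑ g, q f * q g * Real.cosh (l * (y g - y f)) := by
    have hswap : ∑ f, ∑ g, q f * q g * Real.exp (l * (y g - y f))
        = ∑ f, ∑ g, q f * q g * Real.exp (-(l * (y g - y f))) := by
      rw [Finset.sum_comm]
      refine Finset.sum_congr rfl fun f _ => Finset.sum_congr rfl fun g _ => ?_
      rw [mul_comm (q g), show l * (y f - y g) = -(l * (y g - y f)) by ring]
    have hsum : ∑ f, ∑ g, q f * q g * Real.cosh (l * (y g - y f))
        = (∑ f, ∑ g, q f * q g * Real.exp (l * (y g - y f))
          + ∑ f, ∑ g, q f * q g * Real.exp (-(l * (y g - y f)))) / 2 := by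
      simp only [← Finset.sum_add_distrib, Finset.sum_div]
      refine Finset.sum_congr rfl fun f _ => Finset.sum_congr rfl fun g _ => ?_
      rw [Real.cosh_eq]
      ring
    rw [hsum, ← hswap]
    ring
  have prod_le : ∑ f, ∑ g, q f * q g * Real.cosh (l * (y g - y f)) ≤ Real.exp (2 * l ^ 2) := by
    calc ∑ f, ∑ g, q f * q g * Real.cosh (l * (y g - y f))
        ≤ ∑ f, ∑ g, q f * q g * Real.exp (2 * l ^ 2) := by
          gcongr with f _ g _
          · exact mul_nonneg (hq f) (hq g)
          · refine (Real.cosh_le_exp_half_sq _).trans (Real.exp_le_exp.2 ?_)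
            have hf := abs_le.1 (hy f)
            have hg := abs_le.1 (hy g)
            have hsq : (y g - y f) ^ 2 ≤ 2 ^ 2 := sq_le_sq' (by linarith) (by linarith)
            nlinarith [mul_le_mul_of_nonneg_left hsq (sq_nonneg l)]
      _ = Real.exp (2 * l ^ 2) := by
          simp only [← Finset.sum_mul, ← Finset.mul_sum, hq1, one_mul, mul_one]
  have nonneg : 0 ≤ ∑ f, q f * Real.exp (-l * y f) :=
    Finset.sum_nonneg fun f _ => mul_nonneg (hq f) (Real.exp_pos _).le
  rw [Real.exp_sub, le_div_iff₀ (Real.exp_pos _)]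
  calc (∑ f, q f * Real.exp (-l * y f)) * Real.exp (l * ∑ f, q f * y f)
      ≤ (∑ f, q f * Real.exp (-l * y f)) * ∑ g, q g * Real.exp (l * y g) :=
        mul_le_mul_of_nonneg_left jensen nonneg
    _ ≤ Real.exp (2 * l ^ 2) := by rw [prod_eq, prod_symm]; exact prod_le

/-- One round of Exponential Weights at rate `l`: the expected loss plus the new soft minimum
potential is at most the old one plus `2 * l`. -/
theorem expWeights_step {F : Type*} [Fintype F] [Nonempty F] (L y q : F → ℝ)
    (hy : ∀ f, |y f| ≤ 1) {l : ℝ} (hl : 0 < l)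
    (hq : ∀ f, q f = Real.exp (-l * L f) / ∑ g, Real.exp (-l * L g)) :
    ∑ f, q f * y f + (1 / l) * Real.log (∑ f, Real.exp (-l * (L f + y f)))
      ≤ (1 / l) * Real.log (∑ f, Real.exp (-l * L f)) + 2 * l := by
  set Z := ∑ g, Real.exp (-l * L g) with hZ
  have Z_pos : 0 < Z := Finset.sum_pos (fun f _ => Real.exp_pos _) Finset.univ_nonempty
  have q_nonneg : ∀ f, 0 ≤ q f := fun f => by rw [hq]; positivity
  have q_sum : ∑ f, q f = 1 := by
    simp only [hq, ← Finset.sum_div]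
    exact div_self Z_pos.ne'
  have sum_eq : ∑ f, Real.exp (-l * (L f + y f)) = Z * ∑ f, q f * Real.exp (-l * y f) := by
    rw [Finset.mul_sum]
    refine Finset.sum_congr rfl fun f _ => ?_
    rw [hq, mul_add, Real.exp_add]
    field_simp
  have log_le : Real.log (∑ f, Real.exp (-l * (L f + y f)))
      ≤ Real.log Z + (2 * l ^ 2 - l * ∑ f, q f * y f) := by
    have hpos : 0 < ∑ f, Real.exp (-l * (L f + y f)) :=
      Finset.sum_pos (fun f _ => Real.exp_pos _) Finset.univ_nonempty
    rw [Real.log_le_iff_le_exp hpos, Real.exp_add, Real.exp_log Z_pos, sum_eq]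
    exact mul_le_mul_of_nonneg_left (sum_mul_exp_neg_mul_le q y q_nonneg q_sum hy l) Z_pos.le
  have h := mul_le_mul_of_nonneg_left log_le (one_div_pos.2 hl).le
  have hcancel : (1 / l) * (Real.log Z + (2 * l ^ 2 - l * ∑ f, q f * y f))
      = (1 / l) * Real.log Z + 2 * l - ∑ f, q f * y f := by
    field_simp
    ring
  linarith

/-- The soft minimum potential dominates the negated value at each point. -/
theorem neg_le_inv_mul_log_sum_exp {F : Type*} [Fintype F] (L : F → ℝ) {l : ℝ} (hl : 0 < l)
    (f : F) : -L f ≤ (1 / l) * Real.log (∑ g, Real.exp (-l * L g)) := by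
  have hle : Real.exp (-l * L f) ≤ ∑ g, Real.exp (-l * L g) :=
    Finset.single_le_sum (f := fun g => Real.exp (-l * L g))
      (fun g _ => (Real.exp_pos _).le) (Finset.mem_univ f)
  have hlog := (Real.le_log_iff_exp_le ((Real.exp_pos _).trans_le hle)).2 hle
  rw [one_div_mul_eq_div, le_div_iff₀ hl]
  linarith

/-- the parameter-free Exponential Weights algorithm (playing the
Exponential Weights distribution at the learning rate optimizing the relaxation on
each round) has regret at most `2√(2 T log |F|)` (regret bound of Proposition 3). -/
theorem expWeights_regret
    {F X : Type*} [Fintype F] [Nonempty F] [Nonempty X]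
    (ℓ : F → X → ℝ) (hℓ : ∀ f x, |ℓ f x| ≤ 1)
    (T : ℕ) (hT : 0 < T) (x : ℕ → X)
    (lam : ℕ → ℝ) (hlam_pos : ∀ t, t < T → 0 < lam t)
    (hlam_min : ∀ t, t < T → ∀ l : ℝ, 0 < l →
      (1 / lam t) * Real.log (∑ f : F, Real.exp (-(lam t) * ∑ i ∈ Finset.range t, ℓ f (x i)))
          + 2 * lam t * ((T : ℝ) - t)
        ≤ (1 / l) * Real.log (∑ f : F, Real.exp (-l * ∑ i ∈ Finset.range t, ℓ f (x i)))
          + 2 * l * ((T : ℝ) - t))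
    (q : ℕ → F → ℝ)
    (hq : ∀ t, t < T → ∀ f, q t f =
      Real.exp (-(lam t) * ∑ i ∈ Finset.range t, ℓ f (x i))
        / ∑ g : F, Real.exp (-(lam t) * ∑ i ∈ Finset.range t, ℓ g (x i))) :
    (∑ t ∈ Finset.range T, ∑ f, q t f * ℓ f (x t))
        - Finset.univ.inf' Finset.univ_nonempty
            (fun f : F => ∑ t ∈ Finset.range T, ℓ f (x t))
      ≤ 2 * Real.sqrt (2 * T * Real.log (Fintype.card F)) := by
  set Φ : ℕ → ℝ → ℝ := fun t l =>
    (1 / l) * Real.log (∑ f : F, Real.exp (-l * ∑ i ∈ Finset.range t, ℓ f (x i)))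
      + 2 * l * ((T : ℝ) - t) with hΦ
  have telescope : ∀ l₀ : ℝ, 0 < l₀ → ∀ n ≤ T, ∃ l : ℝ, 0 < l ∧
      ∑ t ∈ Finset.range n, ∑ f, q t f * ℓ f (x t) + Φ n l ≤ Φ 0 l₀ := by
    intro l₀ hl₀ n
    induction n with
    | zero => exact fun _ => ⟨l₀, hl₀, by simp⟩
    | succ n ih =>
      intro hn
      obtain ⟨l, hl, hle⟩ := ih (Nat.le_of_succ_le hn)
      refine ⟨lam n, hlam_pos n hn, ?_⟩
      have hmin : Φ n (lam n) ≤ Φ n l := hlam_min n hn l hl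
      have hstep := expWeights_step (fun f => ∑ i ∈ Finset.range n, ℓ f (x i))
        (fun f => ℓ f (x n)) (q n) (fun f => hℓ f (x n)) (hlam_pos n hn) (hq n hn)
      simp only [hΦ, Finset.sum_range_succ, Nat.cast_succ] at hle hmin hstep ⊢
      linarith
  have Φ_zero : ∀ l : ℝ, Φ 0 l = (1 / l) * Real.log (Fintype.card F) + 2 * l * T := by
    intro l
    simp [hΦ]
  have regret_le : ∀ l : ℝ, 0 < l →
      (∑ t ∈ Finset.range T, ∑ f, q t f * ℓ f (x t))
        - Finset.univ.inf' Finset.univ_nonempty (fun f : F => ∑ t ∈ Finset.range T, ℓ f (x t))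
      ≤ (1 / l) * Real.log (Fintype.card F) + 2 * l * T := by
    intro l₀ hl₀
    obtain ⟨l, hl, hle⟩ := telescope l₀ hl₀ T le_rfl
    obtain ⟨f, -, hf⟩ := Finset.exists_mem_eq_inf' Finset.univ_nonempty
      (fun f : F => ∑ t ∈ Finset.range T, ℓ f (x t))
    have hneg := neg_le_inv_mul_log_sum_exp (fun f => ∑ t ∈ Finset.range T, ℓ f (x t)) hl f
    rw [Φ_zero] at hle
    simp only [hΦ, sub_self, mul_zero, add_zero] at hle
    rw [hf]
    linarith
  have T_pos : (0 : ℝ) < T := Nat.cast_pos.2 hT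
  have log_nonneg : 0 ≤ Real.log (Fintype.card F) := Real.log_natCast_nonneg _
  rcases log_nonneg.eq_or_lt with hlog | hlog
  · have hpos := hlam_pos 0 hT
    have hmin : Φ 0 (lam 0) ≤ Φ 0 (lam 0 / 2) := hlam_min 0 hT _ (half_pos hpos)
    rw [Φ_zero, Φ_zero, ← hlog] at hmin
    nlinarith [mul_pos hpos T_pos]
  · set s := Real.sqrt (2 * T * Real.log (Fintype.card F)) with hs
    have s_pos : 0 < s := Real.sqrt_pos.2 (by positivity)
    have s_sq : s ^ 2 = 2 * T * Real.log (Fintype.card F) := Real.sq_sqrt (by positivity)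
    refine (regret_le (s / (2 * T)) (by positivity)).trans_eq ?_
    field_simp
    linarith
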